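/- Let g : [0,∞) → ℝ be defined by g(x) = 3x for 0 ≤ x ≤ 1/3, g(x) = −3x + 2 for 1/3 ≤ x ≤ θ₁, and g(x) = −0.25x + 0.6625 for θ₁ < x ≤ 1, where θ₁ = 1.3375/2.75. Then: (i) g(0.53) = 0.53; (ii) g maps the interval [0.4125, 1] into itself (note g(1) = 0.4125 and g(g(1/3)) = g(1) = 0.4125); (iii) the second iterate g∘g is Lipschitz on [0.4125, 1] with Lipschitz constant 0.75, i.e. |g(g(x)) − g(g(y))| ≤ 0.75|x − y| for all x, y ∈ [0.4125, 1]; and (iv) consequently 0.53 is a globally attracting fixed point of g on [0.4125, 1]: for every x ∈ [0.4125, 1] the iterates gⁿ(x) converge to 0.53 as n → ∞. -/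

import Mathlib

open Real Filter Set Topology

/-- The concrete piecewise linear birth function with `k₁ = 3`, `k₂ = −3`, `k₃ = −0.25`,
`θ = 1/3`, `θ₁ = 1.3375/2.75`, `κ = 0.53`. -/
noncomputable def g19 : ℝ → ℝ := fun x =>
  if x ≤ 1 / 3 then 3 * x
  else if x ≤ 1.3375 / 2.75 then -3 * x + 2
  else -0.25 * x + 0.6625

/-- If the second iterate of `f` contracts distances to `p` on an invariant set,
then all orbits in that set converge to `p`. -/
theorem tendsto_iterate_of_dist_iterate_two_le {α : Type*} [PseudoMetricSpace α] {f : α → α}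
    {s : Set α} {p : α} {K : ℝ} (hK₀ : 0 ≤ K) (hK₁ : K < 1) (hs : MapsTo f s s)
    (hf : ∀ x ∈ s, dist (f (f x)) p ≤ K * dist x p) {x : α} (hx : x ∈ s) :
    Tendsto (fun n => f^[n] x) atTop (𝓝 p) := by
  have bound : ∀ n, dist (f^[n] x) p ≤ K ^ (n / 2) * max (dist x p) (dist (f x) p) := by
    intro n
    induction n using Nat.twoStepInduction with
    | zero => simp
    | one => simp
    | more n ih _ =>
      rw [Function.iterate_succ_apply', Function.iterate_succ_apply',
        Nat.add_div_right n two_pos, pow_succ', mul_assoc]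
      exact (hf _ (hs.iterate n hx)).trans (mul_le_mul_of_nonneg_left ih hK₀)
  have lim : Tendsto (fun n : ℕ => K ^ (n / 2) * max (dist x p) (dist (f x) p)) atTop (𝓝 0) := by
    simpa using ((tendsto_pow_atTop_nhds_zero_of_lt_one hK₀ hK₁).comp
      (Nat.tendsto_div_const_atTop two_ne_zero)).mul_const (max (dist x p) (dist (f x) p))
  exact tendsto_iff_dist_tendsto_zero.2 (squeeze_zero (fun _ => dist_nonneg) bound lim)

theorem g19_of_le {x : ℝ} (h₀ : 0.4125 ≤ x) (h : x ≤ 1.3375 / 2.75) : g19 x = -3 * x + 2 := by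
  have h' : ¬ x ≤ 1 / 3 := by norm_num at h₀ ⊢; linarith
  simp only [g19, if_neg h', if_pos h]

theorem g19_of_lt {x : ℝ} (h : 1.3375 / 2.75 < x) : g19 x = -0.25 * x + 0.6625 := by
  have h' : ¬ x ≤ 1 / 3 := by norm_num at h ⊢; linarith
  simp only [g19, if_neg h', if_neg h.not_ge]

theorem g19_mapsTo : MapsTo g19 (Icc 0.4125 1) (Icc 0.4125 1) := by
  rintro x ⟨h₀, h₁⟩
  rcases le_or_gt x (1.3375 / 2.75) with h | h
  · rw [g19_of_le h₀ h]
    norm_num at *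
    constructor <;> linarith
  · rw [g19_of_lt h]
    norm_num at *
    constructor <;> linarith

/-- `g19 ∘ g19` is piecewise linear on `[0.4125, 1]`, with breakpoints at `θ₁` and at the
preimage of `θ₁` under the third linear piece of `g19`. -/
theorem g19_g19_cases {x : ℝ} (hx : x ∈ Icc (0.4125 : ℝ) 1) :
    (x ≤ 1.3375 / 2.75 ∧ g19 (g19 x) = 0.75 * x + 0.1625) ∨
    (1.3375 / 2.75 < x ∧ x < 31 / 44 ∧ g19 (g19 x) = 0.0625 * x + 0.496875) ∨
    (31 / 44 ≤ x ∧ g19 (g19 x) = 0.75 * x + 0.0125) := by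
  obtain ⟨h₀, h₁⟩ := hx
  rcases le_or_gt x (1.3375 / 2.75) with h | h
  · refine Or.inl ⟨h, ?_⟩
    rw [g19_of_le h₀ h, g19_of_lt (by norm_num at *; linarith)]
    ring
  · rcases lt_or_ge x (31 / 44) with h' | h'
    · refine Or.inr (Or.inl ⟨h, h', ?_⟩)
      rw [g19_of_lt h, g19_of_lt (by norm_num at *; linarith)]
      ring
    · refine Or.inr (Or.inr ⟨h', ?_⟩)
      rw [g19_of_lt h, g19_of_le (by norm_num at *; linarith) (by norm_num at *; linarith)]
      ring

theorem abs_g19_g19_sub_le {x y : ℝ} (hx : x ∈ Icc (0.4125 : ℝ) 1)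
    (hy : y ∈ Icc (0.4125 : ℝ) 1) :
    |g19 (g19 x) - g19 (g19 y)| ≤ 0.75 * |x - y| := by
  wlog hxy : y ≤ x generalizing x y
  · rw [abs_sub_comm, abs_sub_comm x]
    exact this hy hx (le_of_not_ge hxy)
  rw [abs_of_nonneg (sub_nonneg.2 hxy), abs_le]
  rcases g19_g19_cases hx with ⟨h, e⟩ | ⟨h, h', e⟩ | ⟨h, e⟩ <;>
  rcases g19_g19_cases hy with ⟨k, e'⟩ | ⟨k, k', e'⟩ | ⟨k, e'⟩ <;>
  · rw [e, e']
    norm_num at *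
    constructor <;> linarith

theorem g19_fixed : g19 0.53 = 0.53 := by
  rw [g19_of_lt (by norm_num)]
  norm_num

/-- (i) `g(0.53) = 0.53`; (ii) `g` maps `[0.4125, 1]` into itself;
(iii) `g∘g` is `0.75`-Lipschitz on `[0.4125, 1]`; (iv) `0.53` is a globally attracting
fixed point of `g` on `[0.4125, 1]`. -/
theorem stmt19 :
    g19 0.53 = 0.53 ∧
    (∀ x ∈ Icc (0.4125 : ℝ) 1, g19 x ∈ Icc (0.4125 : ℝ) 1) ∧
    (∀ x ∈ Icc (0.4125 : ℝ) 1, ∀ y ∈ Icc (0.4125 : ℝ) 1,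
      |g19 (g19 x) - g19 (g19 y)| ≤ 0.75 * |x - y|) ∧
    (∀ x ∈ Icc (0.4125 : ℝ) 1,
      Tendsto (fun n => g19^[n] x) atTop (𝓝 0.53)) := by
  refine ⟨g19_fixed, g19_mapsTo, fun x hx y hy => abs_g19_g19_sub_le hx hy, fun x hx => ?_⟩
  refine tendsto_iterate_of_dist_iterate_two_le (K := 0.75) (by norm_num) (by norm_num)
    g19_mapsTo (fun y hy => ?_) hx
  have h := abs_g19_g19_sub_le hy (y := 0.53) (by constructor <;> norm_num)
  rwa [g19_fixed, g19_fixed] at h
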